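/- arXiv:1512.04995 — 2 statements merged into one kernel-verified Lean document; each statement's English description precedes it below -/
import Mathlib

section
/- Let G be a finite simple graph, let d be a positive integer, and suppose H is obtained from G by iteratively removing vertices of degree at most d; that is, there is a sequence of distinct vertices v₁, …, v_k of G such that for each i ∈ {1, …, k}, the degree of v_i in the induced subgraph of G on V(G) \ {v₁, …, v_{i−1}} is at most d, and H is the induced subgraph of G on V(G) \ {v₁, …, v_k}. Then the set of edges of G that are not edges of H can be partitioned into d (possibly empty) sets E₁, …, E_d such that for each i ∈ {1, …, d}, the subgraph F_i of G with edge set E_i is a forest (contains no cycle), and every connected component of F_i contains at most one vertex of H. -/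
namespace SimpleGraph

variable {V : Type*}

/-- If every edge joins some vertex to its image under `f`, then the `f`-orbits of any two
vertices in the same component meet. -/
theorem Reachable.exists_iterate_eq_iterate {F : SimpleGraph V} {f : V → V}
    (hf : ∀ a b, F.Adj a b → f a = b ∨ f b = a) {a b : V} (h : F.Reachable a b) :
    ∃ m n : ℕ, f^[m] a = f^[n] b := by
  obtain ⟨p⟩ := h
  induction p with
  | nil => exact ⟨0, 0, rfl⟩
  | @cons a b c hab _ ih =>
    obtain ⟨m, n, hmn⟩ := ih
    rcases hf a b hab with h | h
    · exact ⟨m + 1, n, by rw [Function.iterate_succ_apply, h, hmn]⟩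
    · refine ⟨m, n + 1, ?_⟩
      rw [Function.iterate_succ_apply', ← hmn, ← Function.iterate_succ_apply' f,
        Function.iterate_succ_apply, h]

/-- Two vertices of the same component that are both fixed by the parent map `f` coincide. -/
theorem Reachable.eq_of_isFixedPt {F : SimpleGraph V} {f : V → V}
    (hf : ∀ a b, F.Adj a b → f a = b ∨ f b = a) {a b : V} (h : F.Reachable a b)
    (ha : Function.IsFixedPt f a) (hb : Function.IsFixedPt f b) : a = b := by
  obtain ⟨m, n, hmn⟩ := h.exists_iterate_eq_iterate hf
  rwa [ha.iterate m, hb.iterate n] at hmn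

/-- A graph whose edges all join a vertex to its parent is acyclic if parents have larger rank. -/
theorem isAcyclic_of_parent_rank {F : SimpleGraph V} {f : V → V} {r : V → ℕ}
    (hf : ∀ a b, F.Adj a b → f a = b ∨ f b = a) (hr : ∀ a, f a ≠ a → r a < r (f a)) :
    F.IsAcyclic := by
  classical
  have parent_edge_isBridge : ∀ a, F.Adj a (f a) → F.IsBridge s(a, f a) := by
    intro a ha
    rw [isBridge_iff]
    intro hreach
    -- After deleting the edge above `a`, the vertex `a` becomes its own parent.
    set g : V → V := Function.update f a a with hg
    have hga : Function.IsFixedPt g a := by simp [hg, Function.IsFixedPt]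
    have hgf : ∀ b, b ≠ a → g b = f b := fun b hb => by simp [hg, hb]
    obtain ⟨m, n, hmn⟩ := hreach.exists_iterate_eq_iterate (f := g) (by
      intro b c hbc
      rw [deleteEdges_adj] at hbc
      obtain ⟨hbc, hne⟩ := hbc
      rcases hf b c hbc with h | h
      · left
        rw [hgf b (by rintro rfl; simp [h] at hne), h]
      · right
        rw [hgf c (by rintro rfl; simp [h, Sym2.eq_swap] at hne), h])
    rw [hga.iterate m] at hmn
    have rank_le : ∀ b, r b ≤ r (g b) := by
      intro b
      by_cases hb : b = a
      · rw [hb, hga]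
      · rw [hgf b hb]
        by_cases h : f b = b
        · rw [h]
        · exact (hr b h).le
    have rank_le_iterate : ∀ n b, r b ≤ r (g^[n] b) := by
      intro n
      induction n with
      | zero => exact fun b => le_rfl
      | succ n ih => exact fun b => (rank_le b).trans (ih (g b))
    have := rank_le_iterate n (f a)
    rw [← hmn] at this
    exact absurd (hr a ha.ne') (not_lt.mpr this)
  rw [isAcyclic_iff_forall_adj_isBridge]
  intro a b hab
  rcases hf a b hab with h | h
  · subst h
    exact parent_edge_isBridge a hab
  · subst h
    rw [Sym2.eq_swap]
    exact parent_edge_isBridge b hab.symm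

/-- If every vertex has at most `d` neighbours of larger rank, then the edges between vertices of
different ranks decompose into `d` forests, in each of which every component contains at most one
vertex without neighbours of larger rank. -/
theorem exists_forest_decomposition_of_rank [Fintype V] (G : SimpleGraph V)
    [DecidableRel G.Adj] (r : V → ℕ) {d : ℕ} (hd : 0 < d)
    (hcard : ∀ x, (Finset.univ.filter fun w => G.Adj x w ∧ r x < r w).card ≤ d) :
    ∃ F : Fin d → SimpleGraph V,
      (∀ i, F i ≤ G) ∧
      (Pairwise fun i j => Disjoint (F i).edgeSet (F j).edgeSet) ∧
      (∀ x y, (∃ i, (F i).Adj x y) ↔ G.Adj x y ∧ r x ≠ r y) ∧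
      (∀ i, (F i).IsAcyclic) ∧
      (∀ i a b, (F i).Reachable a b →
        (∀ w, G.Adj a w → r w ≤ r a) → (∀ w, G.Adj b w → r w ≤ r b) → a = b) := by
  classical
  have : Nonempty (Fin d) := ⟨⟨0, hd⟩⟩
  have exists_colour : ∀ x, ∃ c : V → Fin d, Set.InjOn c {w | G.Adj x w ∧ r x < r w} := by
    intro x
    obtain ⟨c, -, hc⟩ := Set.Finite.exists_injOn_of_encard_le
      (s := {w | G.Adj x w ∧ r x < r w}) (t := (Set.univ : Set (Fin d))) (Set.toFinite _) (by
        simpa [Set.encard_eq_coe_toFinset_card] using hcard x)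
    exact ⟨c, hc⟩
  choose c hc using exists_colour
  let F : Fin d → SimpleGraph V := fun i =>
    { Adj := fun x y => G.Adj x y ∧ (r x < r y ∧ c x y = i ∨ r y < r x ∧ c y x = i)
      symm := ⟨fun x y h => ⟨h.1.symm, h.2.symm⟩⟩
      loopless := ⟨fun x h => G.loopless.irrefl x h.1⟩ }
  let f : Fin d → V → V := fun i x =>
    if h : ∃ w, (G.Adj x w ∧ r x < r w) ∧ c x w = i then h.choose else x
  have parent_eq : ∀ i x w, G.Adj x w → r x < r w → c x w = i → f i x = w := by
    intro i x w hadj hlt hcol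
    have h : ∃ w, (G.Adj x w ∧ r x < r w) ∧ c x w = i := ⟨w, ⟨hadj, hlt⟩, hcol⟩
    simp only [f, dif_pos h]
    exact hc x h.choose_spec.1 ⟨hadj, hlt⟩ (h.choose_spec.2.trans hcol.symm)
  have parent_spec : ∀ i x, f i x ≠ x → G.Adj x (f i x) ∧ r x < r (f i x) := by
    intro i x hne
    by_cases h : ∃ w, (G.Adj x w ∧ r x < r w) ∧ c x w = i
    · simp only [f, dif_pos h]
      exact h.choose_spec.1
    · simp [f, dif_neg h] at hne
  have adj_parent : ∀ i a b, (F i).Adj a b → f i a = b ∨ f i b = a := by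
    rintro i a b ⟨hadj, ⟨hlt, hcol⟩ | ⟨hlt, hcol⟩⟩
    · exact Or.inl (parent_eq i a b hadj hlt hcol)
    · exact Or.inr (parent_eq i b a hadj.symm hlt hcol)
  have isFixedPt_of_le : ∀ i a, (∀ w, G.Adj a w → r w ≤ r a) → Function.IsFixedPt (f i) a := by
    intro i a ha
    by_contra hne
    obtain ⟨hadj, hlt⟩ := parent_spec i a hne
    exact absurd hlt (not_lt.mpr (ha _ hadj))
  refine ⟨F, fun i x y h => h.1, ?_, ?_, ?_, ?_⟩
  · intro i j hij
    rw [Set.disjoint_left]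
    intro e
    induction e with
    | _ x y =>
      rintro ⟨-, h⟩ ⟨-, h'⟩
      grind
  · intro x y
    constructor
    · rintro ⟨i, hadj, h⟩
      exact ⟨hadj, by grind⟩
    · rintro ⟨hadj, hne⟩
      rcases lt_or_gt_of_ne hne with h | h
      · exact ⟨c x y, hadj, Or.inl ⟨h, rfl⟩⟩
      · exact ⟨c y x, hadj, Or.inr ⟨h, rfl⟩⟩
  · exact fun i => isAcyclic_of_parent_rank (adj_parent i) fun a ha => (parent_spec i a ha).2
  · exact fun i a b h ha hb =>
      h.eq_of_isFixedPt (adj_parent i) (isFixedPt_of_le i a ha) (isFixedPt_of_le i b hb)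

end SimpleGraph

/-- Let `G` be a finite simple graph, `d` a positive integer, and suppose `H`
is obtained from `G` by iteratively removing vertices of degree at most `d`: there is a
sequence of distinct vertices `v 0, …, v (k-1)` such that each `v i` has degree at most `d`
in the induced subgraph of `G` on the vertices remaining after deleting `v 0, …, v (i-1)`,
and `H` is the induced subgraph of `G` on the remaining vertices (those not in the range
of `v`).  Then the edges of `G` not in `H` can be partitioned into `d` (possibly empty)
forests `F 0, …, F (d-1)`, each of which is a subgraph of `G`, such that every connected
component of each `F i` contains at most one vertex of `H`. -/
theorem thickness_essential_edge_forest_decomposition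
    {V : Type*} [Fintype V] [DecidableEq V] (G : SimpleGraph V) [DecidableRel G.Adj]
    (d : ℕ) (hd : 0 < d) (k : ℕ) (v : Fin k → V) (hv : Function.Injective v)
    (hdeg : ∀ i : Fin k,
      (Finset.univ.filter
        (fun w => G.Adj (v i) w ∧ ∀ j : Fin k, j < i → w ≠ v j)).card ≤ d) :
    ∃ F : Fin d → SimpleGraph V,
      (∀ i, F i ≤ G) ∧
      (Pairwise fun i j => Disjoint ((F i).edgeSet) ((F j).edgeSet)) ∧
      ((⋃ i, (F i).edgeSet) =
        G.edgeSet \ {e ∈ G.edgeSet | ∀ x ∈ e, ∀ i : Fin k, x ≠ v i}) ∧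
      (∀ i, (F i).IsAcyclic) ∧
      (∀ i, ∀ a b : V, (F i).Reachable a b →
        (∀ j : Fin k, a ≠ v j) → (∀ j : Fin k, b ≠ v j) → a = b) := by
  let r : V → ℕ := Function.extend v (fun i => (i : ℕ)) (fun _ => k)
  have rank_removed : ∀ i, r (v i) = i := fun i => hv.extend_apply _ _ i
  have rank_remaining : ∀ x, (∀ i, x ≠ v i) → r x = k := fun x hx =>
    Function.extend_apply' _ _ _ (by rintro ⟨i, rfl⟩; exact hx i rfl)
  have removed_or_remaining : ∀ x, (∃ i, x = v i) ∨ ∀ i, x ≠ v i := fun x => by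
    by_cases h : ∃ i, x = v i
    · exact Or.inl h
    · exact Or.inr (not_exists.mp h)
  have rank_le : ∀ x, r x ≤ k := by
    intro x
    rcases removed_or_remaining x with ⟨i, rfl⟩ | hx
    · rw [rank_removed]
      exact i.isLt.le
    · exact (rank_remaining x hx).le
  have rank_ne_iff : ∀ x y, x ≠ y → (r x ≠ r y ↔ ¬((∀ i, x ≠ v i) ∧ ∀ i, y ≠ v i)) := by
    intro x y hxy
    rcases removed_or_remaining x with ⟨i, rfl⟩ | hx <;>
      rcases removed_or_remaining y with ⟨j, rfl⟩ | hy
    · have hij : (i : ℕ) ≠ j := fun h => hxy (congrArg v (Fin.ext h))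
      simp [rank_removed, hij]
    · simp [rank_removed, rank_remaining y hy, i.isLt.ne]
    · simp [rank_removed, rank_remaining x hx, j.isLt.ne']
    · simp [rank_remaining x hx, rank_remaining y hy, hx, hy]
  obtain ⟨F, hle, hdisj, hadj, hacyc, hreach⟩ :=
    G.exists_forest_decomposition_of_rank r hd (by
      intro x
      rcases removed_or_remaining x with ⟨i, rfl⟩ | hx
      · refine (Finset.card_le_card fun w hw => ?_).trans (hdeg i)
        simp only [Finset.mem_filter, Finset.mem_univ, true_and] at hw ⊢
        refine ⟨hw.1, fun j hj hwj => ?_⟩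
        have hlt := hw.2
        rw [hwj, rank_removed, rank_removed] at hlt
        exact absurd hj (not_lt.mpr hlt.le)
      · simp [rank_remaining x hx, (rank_le _).not_gt])
  refine ⟨F, hle, hdisj, ?_, hacyc, fun i a b h ha hb => hreach i a b h ?_ ?_⟩
  · ext e
    induction e with
    | _ x y =>
      simp only [Set.mem_iUnion, SimpleGraph.mem_edgeSet, hadj, Set.mem_sdiff, Set.mem_ofPred_eq,
        Sym2.mem_iff, forall_eq_or_imp, forall_eq]
      refine and_congr_right fun h => ?_
      rw [rank_ne_iff x y h.ne]
      simp only [h, true_and]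
  · exact fun w _ => (rank_remaining a ha).symm ▸ rank_le w
  · exact fun w _ => (rank_remaining b hb).symm ▸ rank_le w
end

section
/- Let T = (ℝ/ℤ) × (ℝ/ℤ) be the torus and let x be a point of T. Then there exist three loops l₁, l₂, l₃ in T based at x such that: (i) each l_m is simple, i.e., injective on [0,1); (ii) no l_m is path-homotopic (rel endpoints) to the constant loop at x; (iii) the loops l₁, l₂, l₃ are pairwise non-path-homotopic (rel endpoints); and (iv) for all distinct m, n ∈ {1,2,3} and all parameters s, t ∈ [0,1], if l_m(s) = l_n(t) then l_m(s) = x. -/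
namespace AddCircle

/-- The loop based at `c` in the circle `ℝ/ℤ` that winds `a` times around at constant speed. -/
def windingLoop (a : ℤ) (c : AddCircle (1 : ℝ)) : Path c c where
  toFun t := c + a • ((t : ℝ) : AddCircle (1 : ℝ))
  continuous_toFun := continuous_const.add
    (((AddCircle.continuous_mk' (1 : ℝ)).comp continuous_subtype_val).zsmul a)
  source' := by simp
  target' := by simp [AddCircle.coe_period]

/-- The winding number is a homotopy invariant of the loops `windingLoop a c`. -/
theorem eq_of_homotopic_windingLoop {a b : ℤ} {c : AddCircle (1 : ℝ)}
    (h : (windingLoop a c).Homotopic (windingLoop b c)) : a = b := by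
  obtain ⟨r, rfl⟩ := QuotientAddGroup.mk_surjective c
  let lift (n : ℤ) : C(unitInterval, ℝ) := ⟨fun t ↦ r + n • (t : ℝ), by fun_prop⟩
  have hlift : (lift a).HomotopicRel (lift b) {0, 1} := by
    refine ((isCoveringMap_coe (1 : ℝ)).homotopicRel_iff_comp ⟨0, by simp, by simp [lift]⟩).2 ?_
    exact h
  obtain ⟨F⟩ := hlift
  have h1 : lift a 1 = lift b 1 :=
    (F.eq_fst 0 (x := 1) (by simp)).symm.trans (F.eq_snd 0 (by simp))
  simpa [lift] using h1

theorem injOn_coe_unitInterval :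
    Set.InjOn (fun t : unitInterval ↦ ((t : ℝ) : AddCircle (1 : ℝ))) {t | (t : ℝ) < 1} := by
  intro s hs t ht h
  have : Fact ((0 : ℝ) < 1) := ⟨one_pos⟩
  exact Subtype.ext ((coe_eq_coe_iff_of_mem_Ico (a := 0) ⟨s.2.1, by simpa using hs⟩
    ⟨t.2.1, by simpa using ht⟩).1 h)

/-- The loop based at `x` in the torus with winding numbers `a.1` and `a.2`. -/
def torusLoop (a : ℤ × ℤ) (x : AddCircle (1 : ℝ) × AddCircle (1 : ℝ)) : Path x x :=
  (windingLoop a.1 x.1).prod (windingLoop a.2 x.2)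

theorem torusLoop_apply (a : ℤ × ℤ) (x : AddCircle (1 : ℝ) × AddCircle (1 : ℝ))
    (t : unitInterval) :
    torusLoop a x t = (x.1 + a.1 • ((t : ℝ) : AddCircle (1 : ℝ)),
      x.2 + a.2 • ((t : ℝ) : AddCircle (1 : ℝ))) := rfl

theorem torusLoop_zero (x : AddCircle (1 : ℝ) × AddCircle (1 : ℝ)) :
    torusLoop 0 x = Path.refl x := by
  ext t <;> simp [torusLoop_apply]

theorem eq_of_homotopic_torusLoop {a b : ℤ × ℤ} {x : AddCircle (1 : ℝ) × AddCircle (1 : ℝ)}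
    (h : (torusLoop a x).Homotopic (torusLoop b x)) : a = b :=
  Prod.ext (eq_of_homotopic_windingLoop (h.map ⟨Prod.fst, continuous_fst⟩))
    (eq_of_homotopic_windingLoop (h.map ⟨Prod.snd, continuous_snd⟩))

end AddCircle

/-- At any point `x` of the torus `T = (ℝ/ℤ) × (ℝ/ℤ)` there exist three
loops based at `x` that are simple, noncontractible, pairwise non-path-homotopic, and
any two distinct ones of which intersect only at `x`. -/
theorem torus_exists_three_nonhomotopic_loops
    (x : AddCircle (1 : ℝ) × AddCircle (1 : ℝ)) :
    ∃ l : Fin 3 → Path x x,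
      (∀ m, Set.InjOn (l m) {t : unitInterval | (t : ℝ) < 1}) ∧
      (∀ m, ¬ (l m).Homotopic (Path.refl x)) ∧
      (∀ m n, m ≠ n → ¬ (l m).Homotopic (l n)) ∧
      (∀ m n, m ≠ n → ∀ s t : unitInterval, l m s = l n t → l m s = x) := by
  let d : Fin 3 → ℤ × ℤ := ![(1, 0), (0, 1), (1, 1)]
  have hd : Function.Injective d := by decide
  have hd0 : ∀ m, d m ≠ 0 := by decide
  refine ⟨fun m ↦ AddCircle.torusLoop (d m) x, fun m s hs t ht h ↦ ?_, fun m h ↦ ?_,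
    fun m n hmn h ↦ hmn (hd (AddCircle.eq_of_homotopic_torusLoop h)), fun m n hmn s t h ↦ ?_⟩
  · refine AddCircle.injOn_coe_unitInterval hs ht ?_
    fin_cases m <;> simpa [d, AddCircle.torusLoop_apply] using h
  · rw [← AddCircle.torusLoop_zero] at h
    exact hd0 m (AddCircle.eq_of_homotopic_torusLoop h)
  · simp only [AddCircle.torusLoop_apply] at h ⊢
    generalize ((s : ℝ) : AddCircle (1 : ℝ)) = σ at h ⊢
    generalize ((t : ℝ) : AddCircle (1 : ℝ)) = τ at h
    fin_cases m <;> fin_cases n <;> simp [d, Prod.ext_iff] at hmn h ⊢ <;> grind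
end
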